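/- Let (L,(·,·),Φ) be an extended affine root lattice of rank n whose radical Rad(L) has rank r ≥ 1, let w ∈ W(L) be a quasi Coxeter element, and let w̄ be the induced element of the Weyl group of the quotient p.n. root lattice L/Rad(L). Then l(w̄) ≤ n − r and l(w̄) + 2·k_5(L/Rad(L), w̄) ≤ n. -/

import Mathlib

open Submodule

/-- The reflection `s_α : x ↦ x - (2 (x,α) / (α,α)) • α`, as a ℚ-linear endomorphism. -/
noncomputable def reflV {V : Type} [AddCommGroup V] [Module ℚ V]
    (B : V →ₗ[ℚ] V →ₗ[ℚ] ℚ) (α : V) : Module.End ℚ V :=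
  LinearMap.id - ((2 / B α α) • (B.flip α)).smulRight α

/-- `(α_1, …, α_k)` is a presentation of `w`: all `α_i` are roots and
`w = s_{α_1} ∘ ⋯ ∘ s_{α_k}`. -/
def IsPres {V : Type} [AddCommGroup V] [Module ℚ V]
    (B : V →ₗ[ℚ] V →ₗ[ℚ] ℚ) (Φ : Set V) (w : Module.End ℚ V) (l : List V) : Prop :=
  (∀ α ∈ l, α ∈ Φ) ∧ (l.map (reflV B)).prod = w

/-- The length `l(w)`: the minimal length of a presentation of `w`. -/
noncomputable def len {V : Type} [AddCommGroup V] [Module ℚ V]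
    (B : V →ₗ[ℚ] V →ₗ[ℚ] ℚ) (Φ : Set V) (w : Module.End ℚ V) : ℕ :=
  sInf {k | ∃ l : List V, IsPres B Φ w l ∧ l.length = k}

/-- `k₅(M, w)`: the minimal `k` such that `w` has a presentation of length `l(w) + 2k`
whose subroot lattice is the full lattice `M = span ℤ Φ`. -/
noncomputable def k5 {V : Type} [AddCommGroup V] [Module ℚ V]
    (B : V →ₗ[ℚ] V →ₗ[ℚ] ℚ) (Φ : Set V) (w : Module.End ℚ V) : ℕ :=
  sInf {k | ∃ l : List V, IsPres B Φ w l ∧ l.length = len B Φ w + 2 * k ∧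
    span ℤ {α | α ∈ l} = span ℤ Φ}

/-- An extended affine root lattice: a positive semidefinite symmetric ℚ-valued form on
`V = L ⊗ ℚ`, with anisotropic roots `Φ` generating the lattice `L = span ℤ Φ` (a free
ℤ-module of rank `dim V`), integral pairings, and reflections permuting `Φ`.  The radical
of `L` is `L ∩ ker B`, where `ker B = {x | (x, ·) = 0}` is the radical of the form. -/
structure IsEARL {V : Type} [AddCommGroup V] [Module ℚ V]
    (B : V →ₗ[ℚ] V →ₗ[ℚ] ℚ) (Φ : Set V) : Prop where
  symm : ∀ x y : V, B x y = B y x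
  possemidef : ∀ x : V, 0 ≤ B x x
  anisotropic : ∀ α ∈ Φ, B α α ≠ 0
  pair_int : ∀ α ∈ Φ, ∀ β ∈ Φ, ∃ c : ℤ, 2 * B β α = (c : ℚ) * B α α
  refl_maps : ∀ α ∈ Φ, (fun x => x - (2 * B x α / B α α) • α) '' Φ = Φ
  span_rat : span ℚ Φ = ⊤
  lattice_fg : (span ℤ Φ).FG

theorem core_num {V : Type} [AddCommGroup V] [Module ℚ V] (f p p' : V →ₗ[ℚ] ℚ) (α β u : V)
    (s t : Module.End ℚ V) (hs : ∀ x, s x = x - p x • α) (ht : ∀ x, t x = x - p' x • β)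
    (c c' : ℤ) (h1 : p α = 2) (h2 : p' β = 2) (h3 : p β = c) (h4 : p' α = c')
    (hcc : (c ≤ 0 ∧ c' ≤ 0) ∨ (0 < c ∧ 0 < c' ∧ c * c' < 4))
    (hA : 0 < f α) (hB : 0 < f β) (ha : p u < 0) (hb : p' u < 0)
    (R : V → Prop) (hR : R u) (R1 : ∀ x, R x → R (s (t x))) (R2 : ∀ x, R x → R (t (s x)))
    (hmax : ∀ x, R x → f x ≤ f u) : False := by
  have k1 := hmax _ (R1 _ hR)
  have m1 := hmax _ (R2 _ hR)
  have k2 := hmax _ (R1 _ (R1 _ hR))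
  have m2 := hmax _ (R2 _ (R2 _ hR))
  have k3 := hmax _ (R1 _ (R1 _ (R1 _ hR)))
  simp only [hs, ht, map_sub, map_smul, smul_eq_mul, h1, h2, h3, h4] at k1 m1 k2 m2 k3
  clear hmax R1 R2 hR hs ht
  generalize f u = U at *
  obtain ⟨a, ha'⟩ : ∃ a, p u = -a := ⟨-p u, by simp⟩
  obtain ⟨b, hb'⟩ : ∃ b, p' u = -b := ⟨-p' u, by simp⟩
  rw [ha'] at k1 m1 k2 m2 k3 ha
  rw [hb'] at k1 m1 k2 m2 k3 hb
  have ha0 : 0 < a := by linarith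
  have hb0 : 0 < b := by linarith
  generalize f α = A at *
  generalize f β = D at *
  have aA := mul_pos ha0 hA
  have aD := mul_pos ha0 hB
  have bA := mul_pos hb0 hA
  have bD := mul_pos hb0 hB
  have key : ∀ X Y : ℚ, 0 ≤ X → 0 ≤ Y → 0 < X + Y → X * A + Y * D ≤ 0 → False := by
    intro X Y hX hY hXY h
    have := mul_nonneg hX hA.le
    have := mul_nonneg hY hB.le
    have e1 : X * A = 0 := by linarith
    have e2 : Y * D = 0 := by linarith
    have := (mul_eq_zero.1 e1).resolve_right hA.ne'
    have := (mul_eq_zero.1 e2).resolve_right hB.ne'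
    linarith
  rcases hcc with ⟨hc, _⟩ | ⟨hc, hc', hlt⟩
  · have hc : (c : ℚ) ≤ 0 := by exact_mod_cast hc
    have : b * c ≤ 0 := mul_nonpos_of_nonneg_of_nonpos hb0.le hc
    exact key (a - b * c) b (by linarith) hb0.le (by linarith) (by linarith)
  · have h3 : c ≤ 3 := by nlinarith
    have h3' : c' ≤ 3 := by nlinarith
    interval_cases c <;> interval_cases c' <;> try omega
    · norm_num at k1 m1 k2 m2 k3
      rcases le_total (b) (a) with h | h
      · exact key (a-b) (b) (by linarith) (by linarith) (by linarith) (by linarith)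
      exact key (a) (b-a) (by linarith) (by linarith) (by linarith) (by linarith)
    · norm_num at k1 m1 k2 m2 k3
      rcases le_total (b) (a) with h | h
      · exact key (a-b) (b) (by linarith) (by linarith) (by linarith) (by linarith)
      rcases le_total (2*a) (b) with h | h
      · exact key (a) (b-2*a) (by linarith) (by linarith) (by linarith) (by linarith)
      exact key (2*a-b) (2*b-2*a) (by linarith) (by linarith) (by linarith) (by linarith)
    · norm_num at k1 m1 k2 m2 k3
      rcases le_total (b) (a) with h | h
      · exact key (a-b) (b) (by linarith) (by linarith) (by linarith) (by linarith)
      rcases le_total (2*b) (3*a) with h | h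
      · exact key (3*a-2*b) (3*b-3*a) (by linarith) (by linarith) (by linarith) (by linarith)
      rcases le_total (b) (2*a) with h | h
      · exact key (4*a-2*b) (4*b-6*a) (by linarith) (by linarith) (by linarith) (by linarith)
      rcases le_total (b) (3*a) with h | h
      · exact key (3*a-b) (3*b-6*a) (by linarith) (by linarith) (by linarith) (by linarith)
      exact key (a) (b-3*a) (by linarith) (by linarith) (by linarith) (by linarith)
    · norm_num at k1 m1 k2 m2 k3
      rcases le_total (a) (b) with h | h
      · exact key (a) (b-a) (by linarith) (by linarith) (by linarith) (by linarith)
      rcases le_total (2*b) (a) with h | h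
      · exact key (a-2*b) (b) (by linarith) (by linarith) (by linarith) (by linarith)
      exact key (2*a-2*b) (2*b-a) (by linarith) (by linarith) (by linarith) (by linarith)
    · norm_num at k1 m1 k2 m2 k3
      rcases le_total (a) (b) with h | h
      · exact key (a) (b-a) (by linarith) (by linarith) (by linarith) (by linarith)
      rcases le_total (2*a) (3*b) with h | h
      · exact key (3*a-3*b) (3*b-2*a) (by linarith) (by linarith) (by linarith) (by linarith)
      rcases le_total (a) (2*b) with h | h
      · exact key (4*a-6*b) (4*b-2*a) (by linarith) (by linarith) (by linarith) (by linarith)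
      rcases le_total (a) (3*b) with h | h
      · exact key (3*a-6*b) (3*b-a) (by linarith) (by linarith) (by linarith) (by linarith)
      exact key (a-3*b) (b) (by linarith) (by linarith) (by linarith) (by linarith)

section basics
variable {V : Type} [AddCommGroup V] [Module ℚ V]

structure RSys (B : V →ₗ[ℚ] V →ₗ[ℚ] ℚ) (Ψ : Set V) : Prop where
  symm : ∀ x y : V, B x y = B y x
  pos : ∀ x : V, x ≠ 0 → 0 < B x x
  nz : ∀ α ∈ Ψ, α ≠ 0
  int : ∀ α ∈ Ψ, ∀ β ∈ Ψ, ∃ c : ℤ, 2 * B β α = (c : ℚ) * B α α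
  refl : ∀ α ∈ Ψ, ∀ β ∈ Ψ, reflV B α β ∈ Ψ
  fin : Ψ.Finite

theorem reflV_apply (B : V →ₗ[ℚ] V →ₗ[ℚ] ℚ) (α x : V) :
    reflV B α x = x - (2 / B α α * B x α) • α := by
  simp [reflV]

theorem reflV_self (B : V →ₗ[ℚ] V →ₗ[ℚ] ℚ) (α : V) (h : B α α ≠ 0) :
    reflV B α α = -α := by
  rw [reflV_apply, div_mul_cancel₀ _ h, two_smul]; abel

theorem reflV_smul (B : V →ₗ[ℚ] V →ₗ[ℚ] ℚ) (α : V) (c : ℚ) (hc : c ≠ 0) :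
    reflV B (c • α) = reflV B α := by
  ext x
  simp only [reflV_apply, map_smul, LinearMap.smul_apply, smul_eq_mul, smul_smul]
  congr 2
  by_cases h : B α α = 0
  · simp [h]
  · field_simp

theorem reflV_neg (B : V →ₗ[ℚ] V →ₗ[ℚ] ℚ) (α : V) : reflV B (-α) = reflV B α := by
  have := reflV_smul B α (-1) (by norm_num)
  simpa using this

theorem reflV_sq (B : V →ₗ[ℚ] V →ₗ[ℚ] ℚ) (α : V) (h : B α α ≠ 0) (x : V) :
    reflV B α (reflV B α x) = x := by
  rw [reflV_apply B α x, map_sub, map_smul, reflV_self B α h, reflV_apply]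
  simp

theorem reflV_isom (B : V →ₗ[ℚ] V →ₗ[ℚ] ℚ) (hs : ∀ x y, B x y = B y x) (α : V)
    (h : B α α ≠ 0) (x y : V) :
    B (reflV B α x) (reflV B α y) = B x y := by
  simp only [reflV_apply, map_sub, map_smul, LinearMap.sub_apply, LinearMap.smul_apply, smul_eq_mul]
  rw [hs α y]
  field_simp
  ring

theorem reflV_conj (B : V →ₗ[ℚ] V →ₗ[ℚ] ℚ) (hs : ∀ x y, B x y = B y x) (α β : V)
    (h : B α α ≠ 0) :
    reflV B (reflV B α β) = reflV B α * reflV B β * reflV B α := by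
  ext x
  have h1 : B x (reflV B α β) = B (reflV B α x) β := by
    rw [← reflV_isom B hs α h, reflV_sq B α h]
  simp only [Module.End.mul_apply]
  rw [reflV_apply B (reflV B α β), reflV_apply B β, map_sub, map_smul, reflV_sq B α h,
    reflV_isom B hs α h, h1]

theorem RSys.anis {B : V →ₗ[ℚ] V →ₗ[ℚ] ℚ} {Ψ : Set V} (H : RSys B Ψ) {α : V} (h : α ∈ Ψ) :
    B α α ≠ 0 := (H.pos α (H.nz α h)).ne'

theorem improve {B : V →ₗ[ℚ] V →ₗ[ℚ] ℚ} {Ψ : Set V} (H : RSys B Ψ)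
    (f : V →ₗ[ℚ] ℚ) (hf : ∀ α ∈ Ψ, f α ≠ 0)
    (α β u : V) (hα : α ∈ Ψ) (hβ : β ∈ Ψ) (hne : reflV B α ≠ reflV B β)
    (h1 : f u ≤ f (reflV B α u)) (h2 : f u < f (reflV B β u)) :
    ∃ γ ∈ Ψ, ∃ δ ∈ Ψ, reflV B γ * reflV B δ = reflV B α * reflV B β ∧
      f u < f (reflV B δ (reflV B β u)) := by
  have hneg : ∀ α ∈ Ψ, -α ∈ Ψ := fun α h => by
    have := H.refl α h α h
    rwa [reflV_self B α (H.anis h)] at this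
  wlog hA : 0 < f α generalizing α
  · have := this (-α) (hneg _ hα) (by rwa [reflV_neg]) (by rwa [reflV_neg])
      (by rw [map_neg]; have := lt_of_le_of_ne (not_lt.1 hA) (hf α hα); linarith)
    simpa only [reflV_neg] using this
  wlog hB : 0 < f β generalizing β
  · have := this (-β) (hneg _ hβ) (by rwa [reflV_neg]) (by rwa [reflV_neg])
      (by rw [map_neg]; have := lt_of_le_of_ne (not_lt.1 hB) (hf β hβ); linarith)
    simpa only [reflV_neg] using this
  have aα := H.anis hα
  have aβ := H.anis hβ
  have pα := H.pos α (H.nz α hα)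
  have pβ := H.pos β (H.nz β hβ)
  let R : V → Prop := fun x => ∃ γ ∈ Ψ, ∃ δ ∈ Ψ, reflV B γ * reflV B δ = reflV B α * reflV B β ∧
      reflV B δ (reflV B β u) = x
  have hR : R u := ⟨α, hα, β, hβ, rfl, reflV_sq B β aβ u⟩
  have inv : ∀ α ∈ Ψ, reflV B α * reflV B α = 1 := fun α h => by
    ext x; simp [reflV_sq B α (H.anis h)]
  have R1 : ∀ x, R x → R (reflV B α (reflV B β x)) := by
    rintro x ⟨γ, hγ, δ, hδ, e, rfl⟩
    refine ⟨reflV B γ δ, H.refl _ hγ _ hδ, γ, hγ, ?_, ?_⟩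
    · rw [reflV_conj B H.symm γ δ (H.anis hγ), mul_assoc, inv γ hγ, mul_one, e]
    · have : ∀ z, reflV B α (reflV B β z) = reflV B γ (reflV B δ z) := fun z => by
        rw [← Module.End.mul_apply, ← e, Module.End.mul_apply]
      rw [this, reflV_sq B δ (H.anis hδ)]
  have R2 : ∀ x, R x → R (reflV B β (reflV B α x)) := by
    rintro x ⟨γ, hγ, δ, hδ, e, rfl⟩
    refine ⟨δ, hδ, reflV B δ γ, H.refl _ hδ _ hγ, ?_, ?_⟩
    · rw [reflV_conj B H.symm δ γ (H.anis hδ), ← mul_assoc, ← mul_assoc, inv δ hδ, one_mul, e]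
    · have e' : reflV B δ * reflV B γ = reflV B β * reflV B α := by
        calc _ = (reflV B β * reflV B α) * (reflV B α * reflV B β) * (reflV B δ * reflV B γ) := by
              rw [mul_assoc (reflV B β), ← mul_assoc (reflV B α), inv α hα, one_mul, inv β hβ,
                one_mul]
          _ = (reflV B β * reflV B α) * ((reflV B γ * reflV B δ) * (reflV B δ * reflV B γ)) := by
              rw [e, mul_assoc]
          _ = _ := by
              rw [mul_assoc (reflV B γ), ← mul_assoc (reflV B δ), inv δ hδ, one_mul, inv γ hγ,
                mul_one]
      rw [reflV_conj B H.symm δ γ (H.anis hδ), ← Module.End.mul_apply (reflV B β), ← e']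
      rfl
  by_contra hcon
  have hmax : ∀ x, R x → f x ≤ f u := by
    rintro x ⟨γ, hγ, δ, hδ, e, rfl⟩
    by_contra hh
    exact hcon ⟨γ, hγ, δ, hδ, e, not_le.1 hh⟩
  rw [reflV_apply, map_sub, map_smul, smul_eq_mul] at h1 h2
  let p : V →ₗ[ℚ] ℚ := (2 / B α α) • (B.flip α)
  let p' : V →ₗ[ℚ] ℚ := (2 / B β β) • (B.flip β)
  have hp : ∀ x, p x = 2 / B α α * B x α := fun x => by simp [p]
  have hp' : ∀ x, p' x = 2 / B β β * B x β := fun x => by simp [p']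
  rw [← hp] at h1
  rw [← hp'] at h2
  have hb : p' u < 0 := by
    by_contra hh
    have := mul_nonneg (not_lt.1 hh) hB.le
    linarith
  have ha : p u ≤ 0 := by
    by_contra hh
    have := mul_pos (not_le.1 hh) hA
    linarith
  rcases ha.lt_or_eq with ha | ha
  · obtain ⟨c, hc⟩ := H.int α hα β hβ
    obtain ⟨c', hc'⟩ := H.int β hβ α hα
    have ec : p β = c := by rw [hp]; field_simp; linarith
    have ec' : p' α = c' := by rw [hp']; field_simp; linarith
    have e2 : p α = 2 := by rw [hp]; field_simp
    have e2' : p' β = 2 := by rw [hp']; field_simp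
    have hsy := H.symm α β
    refine core_num f p p' α β u (reflV B α) (reflV B β) (fun x => by rw [reflV_apply, hp])
      (fun x => by rw [reflV_apply, hp']) c c' e2 e2' ec ec' ?_ hA hB ha hb R hR R1 R2 hmax
    have hrel : (c : ℚ) * B α α = c' * B β β := by linarith
    rcases le_or_gt c 0 with h0 | h0
    · left
      refine ⟨h0, ?_⟩
      by_contra hh
      have h1 : (c : ℚ) ≤ 0 := by exact_mod_cast h0
      have h2 : (0 : ℚ) < c' := by exact_mod_cast not_le.1 hh
      nlinarith [mul_pos h2 pβ]
    · right
      have h1 : (0 : ℚ) < c := by exact_mod_cast h0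
      have h2 : (0 : ℚ) < c' := by
        by_contra hh
        nlinarith [mul_pos h1 pα]
      refine ⟨h0, by exact_mod_cast h2, ?_⟩
      by_contra hh
      have h4 : (4 : ℚ) ≤ c * c' := by exact_mod_cast not_lt.1 hh
      have hz : B (β - ((c : ℚ) / 2) • α) (β - ((c : ℚ) / 2) • α)
          = B β β * (1 - c * c' / 4) := by
        simp only [map_sub, map_smul, LinearMap.sub_apply, LinearMap.smul_apply, smul_eq_mul]
        rw [hsy]
        have : B β α = c * B α α / 2 := by linarith
        rw [this]
        linear_combination (c / 4 : ℚ) * (-hrel)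
      have hz0 : β - ((c : ℚ) / 2) • α = 0 := by
        by_contra hne
        have := H.pos _ hne
        rw [hz] at this
        nlinarith
      apply hne
      rw [sub_eq_zero.1 hz0, reflV_smul B α _ (by positivity)]
  · have := hmax _ (R2 _ hR)
    rw [reflV_apply B α, ← hp, ha, zero_smul, sub_zero, reflV_apply, ← hp', map_sub, map_smul,
      smul_eq_mul] at this
    linarith

end basics

section stab
variable {V : Type} [AddCommGroup V] [Module ℚ V]

noncomputable def hsum (B : V →ₗ[ℚ] V →ₗ[ℚ] ℚ) (f : V →ₗ[ℚ] ℚ) (v : V) : List V → ℚ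
  | [] => 0
  | α :: l => f (reflV B α ((l.map (reflV B)).prod v)) + hsum B f v l

theorem hsum_lt (B : V →ₗ[ℚ] V →ₗ[ℚ] ℚ) (f : V →ₗ[ℚ] ℚ) (v : V) (l1 m m' : List V)
    (h1 : (m.map (reflV B)).prod = (m'.map (reflV B)).prod)
    (h2 : hsum B f v m < hsum B f v m') :
    hsum B f v (l1 ++ m) < hsum B f v (l1 ++ m') := by
  induction l1 with
  | nil => simpa using h2
  | cons a l ih =>
    simp only [List.cons_append, hsum, List.map_append, List.prod_append, h1]
    linarith

theorem exists_dom {B : V →ₗ[ℚ] V →ₗ[ℚ] ℚ} {Ψ : Set V} (H : RSys B Ψ) (v : V) :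
    ∃ f : V →ₗ[ℚ] ℚ, (∀ α ∈ Ψ, f α ≠ 0) ∧ ∀ α ∈ Ψ, B v α ≠ 0 → 0 < f α * B v α := by
  have : Finite Ψ := H.fin
  obtain ⟨g, hg⟩ := Module.exists_dual_forall_apply_ne_zero (K := ℚ) (fun x : Ψ => (x : V))
    (fun x => H.nz _ x.2)
  obtain ⟨N, hN⟩ := (H.fin.image (fun α => - g α / B v α)).bddAbove
  have hN' : ∀ α ∈ Ψ, B v α ≠ 0 → 0 < ((N + 1) * B v α + g α) * B v α := by
    intro α hα h0
    have h1 : - g α / B v α ≤ N := hN ⟨α, hα, rfl⟩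
    have h2 : 0 < B v α * B v α := mul_self_pos.2 h0
    have h3 : - g α * B v α = (- g α / B v α) * (B v α * B v α) := by field_simp
    nlinarith
  refine ⟨(N + 1) • B v + g, ?_, ?_⟩
  · intro α hα
    by_cases h0 : B v α = 0
    · simpa [h0] using hg ⟨α, hα⟩
    · have := hN' α hα h0
      intro h
      simp at h
      rw [h] at this
      simp at this
  · intro α hα h0
    simpa using hN' α hα h0

theorem stab {B : V →ₗ[ℚ] V →ₗ[ℚ] ℚ} {Ψ : Set V} (H : RSys B Ψ) (v : V) (w : Module.End ℚ V)
    (hw : ∃ l, IsPres B Ψ w l) (hv : w v = v) :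
    ∃ l, IsPres B {α | α ∈ Ψ ∧ B v α = 0} w l := by
  classical
  obtain ⟨f, hf, hfv⟩ := exists_dom H v
  have hex : ∃ k, ∃ l, IsPres B Ψ w l ∧ l.length = k := by
    obtain ⟨l, hl⟩ := hw; exact ⟨_, l, hl, rfl⟩
  have hmin := fun k => @Nat.find_min _ _ hex k
  have hfind := Nat.find_spec hex
  generalize Nat.find hex = k at hmin hfind
  have hfin : {l | IsPres B Ψ w l ∧ l.length = k}.Finite := by
    have : Finite Ψ := H.fin
    refine ((List.finite_length_eq Ψ k).image (List.map Subtype.val)).subset ?_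
    rintro l ⟨hl, hk⟩
    lift l to List Ψ using hl.1
    exact ⟨l, by simpa using hk, rfl⟩
  obtain ⟨l, ⟨hl, hlk⟩, hmax⟩ := Set.exists_max_image _ (hsum B f v) hfin hfind
  have hmem : ∀ α ∈ l, α ∈ Ψ := hl.1
  have main : ∀ m l1, l1 ++ m = l → (∀ α ∈ m, B v α = 0) ∨
      ∃ β m', m = β :: m' ∧ f ((m.map (reflV B)).prod v) < f ((m'.map (reflV B)).prod v) ∧
        f ((m.map (reflV B)).prod v) < f v := by
    intro m
    induction m with
    | nil => intro l1 _; left; simp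
    | cons α m ih =>
      intro l1 hl1
      have hα : α ∈ Ψ := hmem α (by rw [← hl1]; simp)
      rcases ih (l1 ++ [α]) (by simpa using hl1) with h | ⟨β, m', rfl, h1, h2⟩
      · have hfix : (m.map (reflV B)).prod v = v := by
          clear ih hl1
          induction m with
          | nil => simp
          | cons a m ih =>
            simp only [List.map_cons, List.prod_cons, Module.End.mul_apply]
            rw [ih (fun x hx => h x (List.mem_cons_of_mem _ hx)), reflV_apply, h a (by simp)]
            simp
        by_cases h0 : B v α = 0
        · left
          intro x hx
          rcases List.mem_cons.1 hx with rfl | hx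
          · exact h0
          · exact h x hx
        · right
          have hlt : f (reflV B α v) < f v := by
            rw [reflV_apply, map_sub, map_smul, smul_eq_mul]
            have e : 2 / B α α * B v α * f α = 2 / B α α * (f α * B v α) := by ring
            have := H.pos α (H.nz α hα)
            have := hfv α hα h0
            have : 0 < 2 / B α α * (f α * B v α) := by positivity
            linarith
          refine ⟨α, m, rfl, ?_, ?_⟩ <;>
          · simp only [List.map_cons, List.prod_cons, Module.End.mul_apply, hfix]
            exact hlt
      · right
        have hβ : β ∈ Ψ := hmem β (by rw [← hl1]; simp)
        suffices hs : f (((α :: β :: m').map (reflV B)).prod v) <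
            f (((β :: m').map (reflV B)).prod v) from ⟨α, _, rfl, hs, hs.trans h2⟩
        by_contra hcon
        simp only [List.map_cons, List.prod_cons, Module.End.mul_apply, not_lt] at hcon h1
        have hy : reflV B β (reflV B β ((m'.map (reflV B)).prod v)) = (m'.map (reflV B)).prod v :=
          reflV_sq B β (H.anis hβ) _
        by_cases heq : reflV B α = reflV B β
        · refine hmin (l1 ++ m').length ?_ ⟨l1 ++ m', ⟨?_, ?_⟩, rfl⟩
          · rw [← hlk, ← hl1]; simp
          · intro x hx
            apply hmem
            rw [← hl1]
            simp only [List.mem_append, List.mem_cons] at hx ⊢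
            tauto
          · rw [← hl.2, ← hl1]
            simp only [List.map_append, List.prod_append, List.map_cons, List.prod_cons, heq]
            congr 1
            ext x
            simp [reflV_sq B β (H.anis hβ)]
        · obtain ⟨γ, hγ, δ, hδ, e, hlt⟩ := improve H f hf α β _ hα hβ heq hcon (by rwa [hy])
          rw [hy] at hlt
          have hpe : ((γ :: δ :: m').map (reflV B)).prod = ((α :: β :: m').map (reflV B)).prod := by
            simp only [List.map_cons, List.prod_cons, ← mul_assoc, e]
          have hlt2 := hsum_lt B f v l1 (α :: β :: m') (γ :: δ :: m') hpe.symm (by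
            simp only [hsum, List.map_cons, List.prod_cons, Module.End.mul_apply]
            have : ∀ z, reflV B γ (reflV B δ z) = reflV B α (reflV B β z) := fun z => by
              rw [← Module.End.mul_apply, e, Module.End.mul_apply]
            rw [this]
            linarith)
          rw [hl1] at hlt2
          refine absurd (hmax (l1 ++ γ :: δ :: m') ⟨⟨?_, ?_⟩, ?_⟩) (not_le.2 hlt2)
          · intro x hx
            simp only [List.mem_append, List.mem_cons] at hx
            rcases hx with hx | rfl | rfl | hx
            · exact hmem x (by rw [← hl1]; simp [hx])
            · exact hγ
            · exact hδ
            · exact hmem x (by rw [← hl1]; simp [hx])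
          · rw [List.map_append, List.prod_append, hpe, ← List.prod_append, ← List.map_append, hl1,
              hl.2]
          · rw [← hlk, ← hl1]; simp
  rcases main l [] rfl with h | ⟨_, _, _, _, h⟩
  · exact ⟨l, fun x hx => ⟨hmem x hx, h x hx⟩, hl.2⟩
  · rw [hl.2, hv] at h
    exact absurd h (lt_irrefl _)

theorem pres_isom {B : V →ₗ[ℚ] V →ₗ[ℚ] ℚ} {Ψ : Set V} (H : RSys B Ψ) (l : List V)
    (hl : ∀ α ∈ l, α ∈ Ψ) (x : V) :
    B ((l.map (reflV B)).prod x) ((l.map (reflV B)).prod x) = B x x ∧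
    (x ∈ span ℚ Ψ → (l.map (reflV B)).prod x ∈ span ℚ Ψ) := by
  induction l with
  | nil => simp
  | cons a l ih =>
    have ha := hl a (by simp)
    have := ih (fun y hy => hl y (by simp [hy]))
    simp only [List.map_cons, List.prod_cons, Module.End.mul_apply]
    refine ⟨by rw [reflV_isom B H.symm a (H.anis ha), this.1], fun hx => ?_⟩
    rw [reflV_apply]
    exact sub_mem (this.2 hx) (smul_mem _ _ (subset_span ha))

theorem carter [FiniteDimensional ℚ V] {B : V →ₗ[ℚ] V →ₗ[ℚ] ℚ} (d : ℕ) :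
    ∀ {Ψ : Set V} (_ : RSys B Ψ) (_ : Module.finrank ℚ (span ℚ Ψ) ≤ d) (w : Module.End ℚ V)
    (_ : ∃ l, IsPres B Ψ w l), ∃ l, IsPres B Ψ w l ∧ l.length ≤ d := by
  induction d with
  | zero =>
    rintro Ψ H hd w ⟨l, hl⟩
    have : span ℚ Ψ = ⊥ := Submodule.finrank_eq_zero.1 (Nat.le_zero.1 hd)
    cases l with
    | nil => exact ⟨[], hl, by simp⟩
    | cons a l =>
      have ha := hl.1 a (by simp)
      have := subset_span (R := ℚ) ha
      rw [‹span ℚ Ψ = ⊥›] at this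
      exact absurd (by simpa using this) (H.nz a ha)
  | succ d ih =>
    rintro Ψ H hd w ⟨l, hl⟩
    -- reduction step
    have step : ∀ (x : V) (w' : Module.End ℚ V), x ∈ span ℚ Ψ → x ≠ 0 → w' x = x →
        (∃ l, IsPres B Ψ w' l) → ∃ l, IsPres B Ψ w' l ∧ l.length ≤ d := by
      intro x w' hx hx0 hwx hl
      have hs := stab H x w' hl hwx
      have H' : RSys B {α | α ∈ Ψ ∧ B x α = 0} := by
        refine ⟨H.symm, H.pos, fun α h => H.nz α h.1, fun α h β h' => H.int α h.1 β h'.1, ?_,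
          H.fin.subset fun α h => h.1⟩
        intro α h β h'
        refine ⟨H.refl α h.1 β h'.1, ?_⟩
        rw [reflV_apply]
        simp [h.2, h'.2]
      have hlt : span ℚ {α | α ∈ Ψ ∧ B x α = 0} < span ℚ Ψ := by
        refine lt_of_le_of_ne (span_mono fun α h => h.1) fun he => ?_
        rw [← he] at hx
        have hk : span ℚ {α | α ∈ Ψ ∧ B x α = 0} ≤ LinearMap.ker (B x) :=
          span_le.2 fun α h => h.2
        exact (H.pos x hx0).ne' (hk hx)
      have := Submodule.finrank_lt_finrank_of_lt hlt
      obtain ⟨l', h1, h2⟩ := ih H' (by omega) w' hs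
      exact ⟨l', ⟨fun α h => (h1.1 α h).1, h1.2⟩, h2⟩
    cases l with
    | nil => exact ⟨[], hl, by simp⟩
    | cons a l =>
      have ha := hl.1 a (by simp)
      have hmaps : ∀ x ∈ span ℚ Ψ, w x ∈ span ℚ Ψ := fun x hx => by
        rw [← hl.2]; exact (pres_isom H _ hl.1 x).2 hx
      by_cases hfix : ∃ x ∈ span ℚ Ψ, x ≠ 0 ∧ w x = x
      · obtain ⟨x, hx, hx0, hwx⟩ := hfix
        obtain ⟨l', h1, h2⟩ := step x w hx hx0 hwx ⟨_, hl⟩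
        exact ⟨l', h1, by omega⟩
      · let g : span ℚ Ψ →ₗ[ℚ] span ℚ Ψ := (w - 1).restrict (fun x hx => by
          simpa using sub_mem (hmaps x hx) hx)
        have hginj : Function.Injective g := by
          rw [← LinearMap.ker_eq_bot, LinearMap.ker_eq_bot']
          rintro ⟨x, hx⟩ h
          by_contra hne
          refine hfix ⟨x, hx, fun h0 => hne (by simp [h0]), ?_⟩
          have := congrArg Subtype.val h
          simpa [g, sub_eq_zero] using this
        obtain ⟨⟨x, hx⟩, hgx⟩ := (LinearMap.injective_iff_surjective.1 hginj) ⟨a, subset_span ha⟩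
        have hwx : w x - x = a := by simpa [g] using congrArg Subtype.val hgx
        have hiso : B (w x) (w x) = B x x := by rw [← hl.2]; exact (pres_isom H _ hl.1 x).1
        have hx0 : x ≠ 0 := by
          rintro rfl
          simp at hwx
          exact H.nz a ha hwx.symm
        have hax : reflV B a (w x) = x := by
          have e : w x = x + a := by rw [← hwx]; abel
          have h0 := H.anis ha
          have e2 : 2 * B x a + B a a = 0 := by
            rw [e] at hiso
            simp only [map_add, LinearMap.add_apply] at hiso
            rw [H.symm a x] at hiso
            linarith
          rw [reflV_apply, e]
          have : 2 / B a a * B (x + a) a = 1 := by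
            simp only [map_add, LinearMap.add_apply]
            field_simp
            linarith
          rw [this]; simp
        obtain ⟨l', h1, h2⟩ := step x (reflV B a * w) hx hx0 hax ⟨a :: a :: l, by
          intro y hy
          rcases List.mem_cons.1 hy with rfl | hy
          · exact ha
          · exact hl.1 y hy, by rw [List.map_cons, List.prod_cons, hl.2]⟩
        refine ⟨a :: l', ⟨?_, ?_⟩, by simp; omega⟩
        · intro y hy
          rcases List.mem_cons.1 hy with rfl | hy
          · exact ha
          · exact h1.1 y hy
        · rw [List.map_cons, List.prod_cons, h1.2]
          ext y
          simp [reflV_sq B a (H.anis ha)]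

end stab

theorem reflV_det {V : Type} [AddCommGroup V] [Module ℚ V] [FiniteDimensional ℚ V]
    (B : V →ₗ[ℚ] V →ₗ[ℚ] ℚ) (α : V) (h : B α α ≠ 0) : LinearMap.det (reflV B α) = -1 := by
  have : reflV B α = LinearMap.transvection (-((2 / B α α) • (B.flip α))) α := by
    ext x
    simp [reflV_apply, LinearMap.transvection.apply, sub_eq_add_neg]
  rw [this, LinearMap.transvection.det]
  simp [div_mul_cancel₀ _ h]
  norm_num

theorem pres_det {V : Type} [AddCommGroup V] [Module ℚ V] [FiniteDimensional ℚ V]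
    (B : V →ₗ[ℚ] V →ₗ[ℚ] ℚ) (l : List V) (h : ∀ α ∈ l, B α α ≠ 0) :
    LinearMap.det (l.map (reflV B)).prod = (-1) ^ l.length := by
  induction l with
  | nil => simp
  | cons a l ih =>
    rw [List.map_cons, List.prod_cons, map_mul, reflV_det B a (h a (by simp)),
      ih (fun x hx => h x (by simp [hx])), List.length_cons, pow_succ]
    ring

theorem rsys_quot {V : Type} [AddCommGroup V] [Module ℚ V] [FiniteDimensional ℚ V]
    (B : V →ₗ[ℚ] V →ₗ[ℚ] ℚ) (Φ : Set V) (h : IsEARL B Φ)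
    (l : List V) (hlm : ∀ α ∈ l, α ∈ Φ) (hl : span ℤ {α | α ∈ l} = span ℤ Φ)
    (Bq : (V ⧸ LinearMap.ker B) →ₗ[ℚ] (V ⧸ LinearMap.ker B) →ₗ[ℚ] ℚ)
    (hBq : ∀ x y : V, Bq ((LinearMap.ker B).mkQ x) ((LinearMap.ker B).mkQ y) = B x y) :
    RSys Bq ((LinearMap.ker B).mkQ '' Φ) := by
  have hsurj : ∀ z : V ⧸ LinearMap.ker B, ∃ x, (LinearMap.ker B).mkQ x = z :=
    Submodule.mkQ_surjective _
  have hker : ∀ x, B x x = 0 → ∀ y, B x y = 0 := by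
    intro x hx y
    by_contra hne
    have := h.possemidef (y + (-(B y y + 1) / (2 * B x y)) • x)
    simp only [map_add, map_smul, LinearMap.add_apply, LinearMap.smul_apply, smul_eq_mul, hx,
      h.symm y x] at this
    have e : (-(B y y + 1) / (2 * B x y)) * B x y = -(B y y + 1) / 2 := by field_simp
    rw [mul_zero] at this
    linarith
  have hsymm : ∀ x y, Bq x y = Bq y x := by
    intro x y
    obtain ⟨x, rfl⟩ := hsurj x
    obtain ⟨y, rfl⟩ := hsurj y
    rw [hBq, hBq, h.symm]
  have hpos : ∀ x, x ≠ 0 → 0 < Bq x x := by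
    intro x hx
    obtain ⟨x, rfl⟩ := hsurj x
    rw [hBq]
    refine lt_of_le_of_ne (h.possemidef x) fun h0 => hx ?_
    rw [Submodule.mkQ_apply, Submodule.Quotient.mk_eq_zero, LinearMap.mem_ker]
    ext y
    simpa using hker x h0.symm y
  have hnz : ∀ α ∈ (LinearMap.ker B).mkQ '' Φ, α ≠ 0 := by
    rintro _ ⟨α, hα, rfl⟩ h0
    apply h.anisotropic α hα
    rw [← hBq, h0]; simp
  have hint : ∀ α ∈ (LinearMap.ker B).mkQ '' Φ, ∀ β ∈ (LinearMap.ker B).mkQ '' Φ,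
      ∃ c : ℤ, 2 * Bq β α = (c : ℚ) * Bq α α := by
    rintro _ ⟨α, hα, rfl⟩ _ ⟨β, hβ, rfl⟩
    obtain ⟨c, hc⟩ := h.pair_int α hα β hβ
    exact ⟨c, by rw [hBq, hBq, hc]⟩
  refine ⟨hsymm, hpos, hnz, hint, ?_, ?_⟩
  · rintro _ ⟨α, hα, rfl⟩ _ ⟨β, hβ, rfl⟩
    refine ⟨β - (2 * B β α / B α α) • α, ?_, ?_⟩
    · rw [← h.refl_maps α hα]
      exact ⟨β, hβ, rfl⟩
    · rw [reflV_apply, hBq, hBq, map_sub, map_smul]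
      congr 2
      ring
  · let F : (V ⧸ LinearMap.ker B) → (Fin l.length → ℚ) := fun x i =>
      2 * Bq x ((LinearMap.ker B).mkQ (l.get i)) /
        Bq ((LinearMap.ker B).mkQ (l.get i)) ((LinearMap.ker B).mkQ (l.get i))
    have hfin : (Set.pi Set.univ (fun _ : Fin l.length =>
        ((fun c : ℤ => (c : ℚ)) '' Set.Icc (-4) 4))).Finite :=
      Set.Finite.pi fun _ => (Set.finite_Icc _ _).image _
    refine Set.Finite.of_finite_image (f := F) (hfin.subset ?_) ?_
    · rintro _ ⟨α, hα, rfl⟩ i _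
      have hβ : (LinearMap.ker B).mkQ (l.get i) ∈ (LinearMap.ker B).mkQ '' Φ :=
        ⟨_, hlm _ (List.get_mem _ _), rfl⟩
      simp only [F]
      generalize (LinearMap.ker B).mkQ (l.get i) = β at hβ
      have pα := hpos α (hnz α hα)
      have pβ := hpos β (hnz β hβ)
      obtain ⟨c, hc⟩ := hint β hβ α hα
      obtain ⟨c', hc'⟩ := hint α hα β hβ
      refine ⟨c, ?_, by rw [hc]; field_simp⟩
      rw [hsymm β α] at hc'
      have hrel : (c : ℚ) * Bq β β = c' * Bq α α := by linarith
      have hz : Bq (α - ((c : ℚ) / 2) • β) (α - ((c : ℚ) / 2) • β)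
          = Bq α α * (1 - c * c' / 4) := by
        simp only [map_sub, map_smul, LinearMap.sub_apply, LinearMap.smul_apply, smul_eq_mul]
        rw [hsymm β α]
        have : Bq α β = c * Bq β β / 2 := by linarith
        rw [this]
        linear_combination (c / 4 : ℚ) * (-hrel)
      have hz0 : 0 ≤ Bq (α - ((c : ℚ) / 2) • β) (α - ((c : ℚ) / 2) • β) := by
        by_cases h0 : α - ((c : ℚ) / 2) • β = 0
        · simp [h0]
        · exact (hpos _ h0).le
      rw [hz] at hz0
      have h4 : (c : ℚ) * c' ≤ 4 := by
        by_contra hh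
        nlinarith
      have h4 : c * c' ≤ 4 := by exact_mod_cast h4
      rw [Set.mem_Icc]
      rcases lt_trichotomy c 0 with h0 | h0 | h0
      · have h1 : (c : ℚ) < 0 := by exact_mod_cast h0
        have h2 : (c' : ℚ) < 0 := by
          by_contra hh
          nlinarith [mul_pos (neg_pos.2 h1) pβ]
        have h2 : c' < 0 := by exact_mod_cast h2
        constructor <;> nlinarith
      · omega
      · have h1 : (0 : ℚ) < c := by exact_mod_cast h0
        have h2 : (0 : ℚ) < c' := by
          by_contra hh
          nlinarith [mul_pos h1 pβ]
        have h2 : 0 < c' := by exact_mod_cast h2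
        constructor <;> nlinarith
    · intro x _ y _ hxy
      by_contra hne
      have hd : x - y ≠ 0 := sub_ne_zero.2 hne
      apply (hpos _ hd).ne'
      have hz : ∀ i, Bq (x - y) ((LinearMap.ker B).mkQ (l.get i)) = 0 := by
        intro i
        have := congrFun hxy i
        have hβ := (hpos _ (hnz _ ⟨_, hlm _ (List.get_mem l i), rfl⟩)).ne'
        simp only [F] at this
        rw [div_left_inj' hβ] at this
        rw [map_sub, LinearMap.sub_apply]
        linarith
      have hspan : span ℚ {α | α ∈ l} = ⊤ := by
        rw [eq_top_iff, ← h.span_rat, span_le]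
        intro α hα
        have h1 : α ∈ span ℤ {α | α ∈ l} := by rw [hl]; exact subset_span hα
        exact Submodule.span_le_restrictScalars ℤ ℚ _ h1
      have hle : span ℚ {α | α ∈ l} ≤ LinearMap.ker ((Bq (x - y)).comp (LinearMap.ker B).mkQ) := by
        rw [span_le]
        intro α hα
        obtain ⟨i, rfl⟩ := List.get_of_mem hα
        exact hz i
      obtain ⟨z, hzz⟩ := hsurj (x - y)
      have : z ∈ LinearMap.ker ((Bq (x - y)).comp (LinearMap.ker B).mkQ) :=
        hle (by rw [hspan]; trivial)
      rw [LinearMap.mem_ker, LinearMap.comp_apply, hzz] at this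
      exact this

/-- If `w` is a quasi Coxeter element of an extended affine root lattice of rank `n`
with radical of rank `r ≥ 1`, and `w̄` is the induced element of the Weyl group of the
quotient p.n. root lattice `L/Rad(L)` (with induced form `B̄` and roots `π '' Φ`,
`π : V → V/Rad` the projection), then `l(w̄) ≤ n - r` and
`l(w̄) + 2 k₅(L/Rad(L), w̄) ≤ n`. -/
theorem stmt19 {V : Type} [AddCommGroup V] [Module ℚ V] [FiniteDimensional ℚ V]
    (B : V →ₗ[ℚ] V →ₗ[ℚ] ℚ) (Φ : Set V) (h : IsEARL B Φ)
    (n r : ℕ) (hn : Module.finrank ℚ V = n)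
    (hr : Module.finrank ℚ (LinearMap.ker B) = r) (hr1 : 1 ≤ r)
    (w : Module.End ℚ V)
    (hw : ∃ l : List V, IsPres B Φ w l ∧ l.length = n ∧ span ℤ {α | α ∈ l} = span ℤ Φ)
    (Bq : (V ⧸ LinearMap.ker B) →ₗ[ℚ] (V ⧸ LinearMap.ker B) →ₗ[ℚ] ℚ)
    (hBq : ∀ x y : V, Bq ((LinearMap.ker B).mkQ x) ((LinearMap.ker B).mkQ y) = B x y)
    (wq : Module.End ℚ (V ⧸ LinearMap.ker B))
    (hwq : ∀ x : V, wq ((LinearMap.ker B).mkQ x) = (LinearMap.ker B).mkQ (w x)) :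
    len Bq ((LinearMap.ker B).mkQ '' Φ) wq ≤ n - r ∧
    len Bq ((LinearMap.ker B).mkQ '' Φ) wq +
      2 * k5 Bq ((LinearMap.ker B).mkQ '' Φ) wq ≤ n := by

  obtain ⟨l, hl, hlen, hspan⟩ := hw
  have H := rsys_quot B Φ h l hl.1 hspan Bq hBq
  have hsurj : Function.Surjective (LinearMap.ker B).mkQ := Submodule.mkQ_surjective _
  have hrefl : ∀ α x : V, reflV Bq ((LinearMap.ker B).mkQ α) ((LinearMap.ker B).mkQ x) =
      (LinearMap.ker B).mkQ (reflV B α x) := by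
    intro α x
    rw [reflV_apply, reflV_apply, hBq, hBq, map_sub, map_smul]
  have hprod : ∀ (m : List V) (x : V),
      ((m.map (LinearMap.ker B).mkQ).map (reflV Bq)).prod ((LinearMap.ker B).mkQ x) =
        (LinearMap.ker B).mkQ ((m.map (reflV B)).prod x) := by
    intro m x
    induction m with
    | nil => simp
    | cons a m ih =>
      simp only [List.map_cons, List.prod_cons, Module.End.mul_apply]
      rw [ih, hrefl]
  have hpres : IsPres Bq ((LinearMap.ker B).mkQ '' Φ) wq (l.map (LinearMap.ker B).mkQ) := by
    refine ⟨?_, ?_⟩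
    · intro α hα
      obtain ⟨a, ha, rfl⟩ := List.mem_map.1 hα
      exact ⟨a, hl.1 a ha, rfl⟩
    · apply LinearMap.ext
      intro z
      obtain ⟨x, rfl⟩ := hsurj z
      rw [hprod, hl.2, hwq]
  have hdim : Module.finrank ℚ (V ⧸ LinearMap.ker B) = n - r := by
    have := Submodule.finrank_quotient_add_finrank (LinearMap.ker B)
    omega
  obtain ⟨l', hl', hlen'⟩ := carter (n - r) H
    (hdim ▸ Submodule.finrank_le _) wq ⟨_, hpres⟩
  have hle : len Bq ((LinearMap.ker B).mkQ '' Φ) wq ≤ n - r :=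
    le_trans (Nat.sInf_le ⟨l', hl', rfl⟩) hlen'
  refine ⟨hle, ?_⟩
  obtain ⟨l0, hl0, hlen0⟩ : ∃ l0, IsPres Bq ((LinearMap.ker B).mkQ '' Φ) wq l0 ∧
      l0.length = len Bq ((LinearMap.ker B).mkQ '' Φ) wq :=
    Nat.sInf_mem (s := {k | ∃ l, IsPres Bq ((LinearMap.ker B).mkQ '' Φ) wq l ∧ l.length = k})
      ⟨_, _, hpres, rfl⟩
  have d1 := pres_det Bq l0 (fun α hα => H.anis (hl0.1 α hα))
  have d2 := pres_det Bq _ (fun α hα => H.anis (hpres.1 α hα))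
  rw [hl0.2, hlen0] at d1
  rw [hpres.2, d1, List.length_map, hlen] at d2
  have hpar : Even (len Bq ((LinearMap.ker B).mkQ '' Φ) wq) ↔ Even n := by
    rw [← neg_one_pow_eq_one_iff_even (R := ℚ) (by norm_num), d2,
      neg_one_pow_eq_one_iff_even (by norm_num)]
  generalize hL : len Bq ((LinearMap.ker B).mkQ '' Φ) wq = L at *
  obtain ⟨k, hk⟩ : ∃ k, n = L + 2 * k := by
    refine ⟨(n - L) / 2, ?_⟩
    rw [Nat.even_iff, Nat.even_iff] at hpar
    omega
  have hk5 : k5 Bq ((LinearMap.ker B).mkQ '' Φ) wq ≤ k := by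
    refine Nat.sInf_le ⟨l.map (LinearMap.ker B).mkQ, hpres, ?_, ?_⟩
    · rw [hL, List.length_map, hlen, hk]
    · have e : {α | α ∈ l.map (LinearMap.ker B).mkQ} =
          ((LinearMap.ker B).mkQ.restrictScalars ℤ) '' {α | α ∈ l} := by
        ext; simp
      have e' : (LinearMap.ker B).mkQ '' Φ = ((LinearMap.ker B).mkQ.restrictScalars ℤ) '' Φ := rfl
      rw [e, e', Submodule.span_image, Submodule.span_image, hspan]
  omega
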